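/- arXiv:1510.01722 — 2 statements merged into one kernel-verified Lean document; each statement's English description precedes it below -/
import Mathlib

section
/- For every invertible n×n Toeplitz matrix T over ℝ there exist vectors g_1, g_2, h_1, h_2 ∈ ℝ^n such that T^{-1} = Σ_{i=1}^{2} Z_1(g_i)·Z_{−1}(h_i). -/
open Matrix BigOperators

noncomputable section

/-- The `f`-unit-circulant matrix `Z_f = [e2, e3, ..., en, f*e1]`:
`(Z_f)_{ij} = 1` if `i = j+1`, `f` if `(i,j) = (1,n)` (1-indexed), and `0` otherwise. -/
def Zunit (R : Type*) [CommRing R] (n : ℕ) (f : R) : Matrix (Fin n) (Fin n) R :=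
  Matrix.of fun i j => if (i : ℕ) = (j : ℕ) + 1 then 1
    else if (i : ℕ) = 0 ∧ (j : ℕ) = n - 1 then f else 0

/-- `krylov A v = [v, Av, A²v, ..., A^{n−1}v]`, whose `j`-th column (0-indexed) is `A^j v`. -/
def krylov {R : Type*} [CommRing R] {n : ℕ} (A : Matrix (Fin n) (Fin n) R)
    (v : Fin n → R) : Matrix (Fin n) (Fin n) R :=
  Matrix.of fun i j => (A ^ (j : ℕ)).mulVec v i

/-- The `f`-circulant matrix `Z_f(v) = krylov(Z_f, v)`. -/
def Zcirc (R : Type*) [CommRing R] (n : ℕ) (f : R) (v : Fin n → R) :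
    Matrix (Fin n) (Fin n) R :=
  krylov (Zunit R n f) v

/-- A matrix is Toeplitz if its entries depend only on `i - j`. -/
def IsToeplitz {n : ℕ} (T : Matrix (Fin n) (Fin n) ℝ) : Prop :=
  ∀ i j i' j' : Fin n, (i : ℤ) - (j : ℤ) = (i' : ℤ) - (j' : ℤ) → T i j = T i' j'

/-- A matrix is Hankel if its entries depend only on `i + j`. -/
def IsHankel {n : ℕ} (H : Matrix (Fin n) (Fin n) ℝ) : Prop :=
  ∀ i j i' j' : Fin n, (i : ℕ) + (j : ℕ) = (i' : ℕ) + (j' : ℕ) → H i j = H i' j'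

/-- The DFT matrix `Ω_{jk} = ω^{jk}` (0-indexed) with `ω = exp(-2πi/n)`. -/
def dft (n : ℕ) : Matrix (Fin n) (Fin n) ℂ :=
  Matrix.of fun j k => Complex.exp (-2 * Real.pi * Complex.I / n) ^ ((j : ℕ) * (k : ℕ))

section UnitCirculant

variable {R : Type*} [CommRing R] {m : ℕ} (f : R)

theorem Zunit_succ_apply (i : Fin m) (j : Fin (m + 1)) :
    Zunit R (m + 1) f i.succ j = if j = i.castSucc then 1 else 0 := by
  simp only [Zunit, of_apply, Fin.ext_iff, Fin.val_succ, Fin.val_castSucc]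
  grind

theorem Zunit_zero_apply (j : Fin (m + 1)) :
    Zunit R (m + 1) f 0 j = if j = Fin.last m then f else 0 := by
  simp only [Zunit, of_apply, Fin.ext_iff, Fin.val_zero, Fin.val_last]
  grind

theorem Zunit_apply_castSucc (i : Fin (m + 1)) (j : Fin m) :
    Zunit R (m + 1) f i j.castSucc = if i = j.succ then 1 else 0 := by
  simp only [Zunit, of_apply, Fin.ext_iff, Fin.val_succ, Fin.val_castSucc]
  grind

theorem Zunit_apply_last (i : Fin (m + 1)) :
    Zunit R (m + 1) f i (Fin.last m) = if i = 0 then f else 0 := by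
  simp only [Zunit, of_apply, Fin.ext_iff, Fin.val_zero, Fin.val_last]
  grind

theorem Zunit_mulVec_zero (v : Fin (m + 1) → R) :
    (Zunit R (m + 1) f *ᵥ v) 0 = f * v (Fin.last m) := by
  simp [mulVec, dotProduct, Zunit_zero_apply]

theorem Zunit_mulVec_succ (v : Fin (m + 1) → R) (i : Fin m) :
    (Zunit R (m + 1) f *ᵥ v) i.succ = v i.castSucc := by
  simp [mulVec, dotProduct, Zunit_succ_apply]

theorem Zunit_mul_zero (M : Matrix (Fin (m + 1)) (Fin (m + 1)) R) (j : Fin (m + 1)) :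
    (Zunit R (m + 1) f * M) 0 j = f * M (Fin.last m) j := by
  simp [mul_apply, Zunit_zero_apply]

theorem Zunit_mul_succ (M : Matrix (Fin (m + 1)) (Fin (m + 1)) R) (i : Fin m)
    (j : Fin (m + 1)) :
    (Zunit R (m + 1) f * M) i.succ j = M i.castSucc j := by
  simp [mul_apply, Zunit_succ_apply]

theorem mul_Zunit_castSucc (M : Matrix (Fin (m + 1)) (Fin (m + 1)) R) (i : Fin (m + 1))
    (j : Fin m) : (M * Zunit R (m + 1) f) i j.castSucc = M i j.succ := by
  simp [mul_apply, Zunit_apply_castSucc]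

theorem mul_Zunit_last (M : Matrix (Fin (m + 1)) (Fin (m + 1)) R) (i : Fin (m + 1)) :
    (M * Zunit R (m + 1) f) i (Fin.last m) = M i 0 * f := by
  simp [mul_apply, Zunit_apply_last]

theorem Zunit_pow_mulVec (v : Fin (m + 1) → R) (k : ℕ) (hk : k ≤ m + 1) (i : Fin (m + 1)) :
    (Zunit R (m + 1) f ^ k *ᵥ v) i =
      if k ≤ (i : ℕ) then v (Fin.ofNat (m + 1) (i - k))
      else f * v (Fin.ofNat (m + 1) (m + 1 + i - k)) := by
  induction k generalizing i with
  | zero => simp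
  | succ k ih =>
    rw [pow_succ', ← mulVec_mulVec]
    cases i using Fin.cases with
    | zero =>
      rw [Zunit_mulVec_zero, ih (by omega), if_pos (by simp; omega)]
      simp
    | succ i =>
      rw [Zunit_mulVec_succ, ih (by omega)]
      simp only [Fin.val_castSucc, Fin.val_succ, Nat.add_le_add_iff_right,
        Nat.add_sub_add_right, ← add_assoc]

theorem Zunit_pow_self : Zunit R (m + 1) f ^ (m + 1) = f • 1 := by
  refine ext_of_mulVec_single fun j => funext fun i => ?_
  rw [Zunit_pow_mulVec f _ _ le_rfl, if_neg (by omega)]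
  simp [one_apply, Pi.single_apply]

theorem Zcirc_apply_zero (v : Fin (m + 1) → R) (i : Fin (m + 1)) :
    Zcirc R (m + 1) f v i 0 = v i := by
  simp [Zcirc, krylov]

theorem Zcirc_apply_last (v : Fin (m + 1) → R) (j : Fin (m + 1)) :
    Zcirc R (m + 1) f v (Fin.last m) j = v j.rev := by
  have hj : (j : ℕ) ≤ m := by omega
  simp only [Zcirc, krylov, of_apply]
  rw [Zunit_pow_mulVec f _ _ (by omega), if_pos (by simpa using hj)]
  congr 1
  ext
  simp [Fin.val_rev, Nat.mod_eq_of_lt (show m - (j : ℕ) < m + 1 by omega)]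

theorem commute_Zunit_Zcirc (v : Fin (m + 1) → R) :
    Commute (Zunit R (m + 1) f) (Zcirc R (m + 1) f v) := by
  ext i j
  have h : (Zunit R (m + 1) f * Zcirc R (m + 1) f v) i j =
      (Zunit R (m + 1) f ^ ((j : ℕ) + 1) *ᵥ v) i := by
    rw [pow_succ', ← mulVec_mulVec]
    rfl
  rw [h]
  cases j using Fin.lastCases with
  | last =>
    rw [mul_Zunit_last, Zcirc_apply_zero, Fin.val_last, Zunit_pow_self]
    simp [smul_mulVec, mul_comm]
  | cast j =>
    rw [mul_Zunit_castSucc]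
    simp [Zcirc, krylov]

theorem Zunit_sub_Zunit (g : R) :
    Zunit R (m + 1) f - Zunit R (m + 1) g =
      vecMulVec (Pi.single 0 (f - g)) (Pi.single (Fin.last m) 1) := by
  ext i j
  cases i using Fin.cases with
  | zero => by_cases h : j = Fin.last m <;> simp [Zunit_zero_apply, vecMulVec_apply, h]
  | succ i => simp [Zunit_succ_apply, vecMulVec_apply]

theorem Zcirc_mul_Zcirc_displacement (g : R) (u w : Fin (m + 1) → R) :
    Zcirc R (m + 1) f u * Zcirc R (m + 1) g w * Zunit R (m + 1) g -
      Zunit R (m + 1) f * (Zcirc R (m + 1) f u * Zcirc R (m + 1) g w) =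
      vecMulVec ((g - f) • u) (fun j => w j.rev) := by
  rw [mul_assoc, ← (commute_Zunit_Zcirc g w).eq, ← mul_assoc (Zunit R (m + 1) f),
    (commute_Zunit_Zcirc f u).eq, mul_assoc, ← mul_sub, ← sub_mul, Zunit_sub_Zunit,
    vecMulVec_mul, mul_vecMulVec]
  congr 1
  · ext i
    simp [Zcirc_apply_zero, mul_comm]
  · ext j
    simp [Zcirc_apply_last]

end UnitCirculant

theorem eq_of_Zunit_displacement_eq {m : ℕ} {A B : Matrix (Fin (m + 1)) (Fin (m + 1)) ℝ}
    (h : A * Zunit ℝ (m + 1) (-1) - Zunit ℝ (m + 1) 1 * A =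
      B * Zunit ℝ (m + 1) (-1) - Zunit ℝ (m + 1) 1 * B) : A = B := by
  have hX : SemiconjBy (A - B) (Zunit ℝ (m + 1) (-1)) (Zunit ℝ (m + 1) 1) := by
    rw [SemiconjBy, ← sub_eq_zero, ← sub_eq_zero.2 h]
    noncomm_ring
  have hpow := (hX.pow_right (m + 1)).eq
  rw [Zunit_pow_self, Zunit_pow_self] at hpow
  ext i j
  have := congrFun (congrFun hpow i) j
  simp at this
  linarith

theorem IsToeplitz.exists_displacement {m : ℕ} {T : Matrix (Fin (m + 1)) (Fin (m + 1)) ℝ}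
    (hT : IsToeplitz T) (f g : ℝ) :
    ∃ a b : Fin (m + 1) → ℝ, Zunit ℝ (m + 1) f * T - T * Zunit ℝ (m + 1) g =
      vecMulVec (Pi.single 0 1) a + vecMulVec b (Pi.single (Fin.last m) 1) := by
  set D := Zunit ℝ (m + 1) f * T - T * Zunit ℝ (m + 1) g with hD
  refine ⟨D 0, fun i => if i = 0 then 0 else D i (Fin.last m), ?_⟩
  ext i j
  cases i using Fin.cases with
  | zero => simp [vecMulVec_apply]
  | succ i =>
    cases j using Fin.lastCases with
    | last => simp [vecMulVec_apply]
    | cast j =>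
      have := hT i.castSucc j.castSucc i.succ j.succ (by simp)
      simp [vecMulVec_apply, hD, Zunit_mul_succ, mul_Zunit_castSucc, this]

theorem toeplitz_inverse_in_class {n : ℕ} (T : Matrix (Fin n) (Fin n) ℝ)
    (hT : IsToeplitz T) (hu : IsUnit T) :
    ∃ g h : Fin 2 → (Fin n → ℝ),
      T⁻¹ = ∑ i : Fin 2, Zcirc ℝ n 1 (g i) * Zcirc ℝ n (-1) (h i) := by
  cases n with
  | zero => exact ⟨0, 0, Subsingleton.elim _ _⟩
  | succ m =>
    obtain ⟨a, b, hab⟩ := hT.exists_displacement (-1) 1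
    have hdet := (isUnit_iff_isUnit_det T).1 hu
    refine ⟨![T⁻¹ *ᵥ Pi.single 0 1, T⁻¹ *ᵥ b],
      ![fun j => -(a ᵥ* T⁻¹) j.rev / 2, fun j => -(Pi.single (Fin.last m) 1 ᵥ* T⁻¹) j.rev / 2],
      eq_of_Zunit_displacement_eq ?_⟩
    have hinv : T⁻¹ * Zunit ℝ (m + 1) (-1) - Zunit ℝ (m + 1) 1 * T⁻¹ =
        T⁻¹ * (Zunit ℝ (m + 1) (-1) * T - T * Zunit ℝ (m + 1) 1) * T⁻¹ := by
      rw [mul_sub, sub_mul, mul_assoc, mul_assoc, mul_nonsing_inv T hdet, mul_one,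
        ← mul_assoc T⁻¹ T, nonsing_inv_mul T hdet, one_mul]
    rw [hinv, hab, Fin.sum_univ_two, add_mul, mul_add (Zunit ℝ (m + 1) 1), add_sub_add_comm,
      Zcirc_mul_Zcirc_displacement, Zcirc_mul_Zcirc_displacement, mul_add, add_mul,
      mul_vecMulVec, mul_vecMulVec, vecMulVec_mul, vecMulVec_mul]
    congr 1 <;>
    · ext i j
      simp [vecMulVec_apply]
      ring
end
end

section
/- For all vectors g, h, x ∈ ℝ^n the following two identities hold: (a) Z_1(g)·Z_{−1}(h)·x = Z_1(Z_{−1}(h)·x)·g, and (b) Z_1(g)·Z_{−1}(h)·x = Z_1(g)·Z_{−1}(x)·h. Equivalently, for the transform f(x, G, H) = Σ_{i=1}^{r} Z_1(g_i)·Z_{−1}(h_i)·x, the Jacobian with respect to the column g_j is Z_1(Z_{−1}(h_j)·x) and the Jacobian with respect to the column h_j is Z_1(g_j)·Z_{−1}(x). -/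
open Matrix BigOperators

noncomputable section

theorem krylov_mulVec {R : Type*} [CommRing R] {n : ℕ} (A : Matrix (Fin n) (Fin n) R)
    (v w : Fin n → R) :
    (krylov A v).mulVec w = (∑ j : Fin n, w j • A ^ (j : ℕ)).mulVec v := by
  ext i
  simp only [Matrix.sum_mulVec, Matrix.smul_mulVec, Finset.sum_apply, Pi.smul_apply, smul_eq_mul]
  simp only [krylov, Matrix.mulVec_eq_sum (v := w), Finset.sum_apply, Pi.smul_apply,
    MulOpposite.smul_eq_mul_unop, MulOpposite.unop_op, Matrix.transpose_apply, Matrix.of_apply]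
  exact Finset.sum_congr rfl fun _ _ => mul_comm _ _

theorem Zunit_pow_mulVec_single_zero (R : Type*) [CommRing R] {n : ℕ} (f : R) (k : ℕ)
    (hk : k < n) :
    (Zunit R n f ^ k).mulVec (Pi.single ⟨0, by omega⟩ 1) = Pi.single ⟨k, hk⟩ 1 := by
  induction k with
  | zero => rw [pow_zero, Matrix.one_mulVec]
  | succ k ih =>
    rw [pow_succ', ← Matrix.mulVec_mulVec, ih (by omega), Matrix.mulVec_single_one]
    ext i
    have hlast : k ≠ n - 1 := by omega
    simp [Zunit, Pi.single_apply, Fin.ext_iff, hlast]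

theorem krylov_Zunit_single_zero (R : Type*) [CommRing R] {n : ℕ} (hn : 0 < n) (f : R) :
    krylov (Zunit R n f) (Pi.single ⟨0, hn⟩ 1) = 1 := by
  ext i j
  rw [krylov, Matrix.of_apply, Zunit_pow_mulVec_single_zero R f j j.isLt, Matrix.one_apply,
    Pi.single_apply]

/-- The product of an `f`-circulant matrix with a vector is symmetric in the two vectors. -/
theorem Zcirc_mulVec_comm {R : Type*} [CommRing R] {n : ℕ} (f : R) (v w : Fin n → R) :
    (Zcirc R n f v).mulVec w = (Zcirc R n f w).mulVec v := by
  rcases Nat.eq_zero_or_pos n with rfl | hn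
  · exact Subsingleton.elim _ _
  have hrep (u : Fin n → R) :
      (∑ j : Fin n, u j • Zunit R n f ^ (j : ℕ)).mulVec (Pi.single ⟨0, hn⟩ 1) = u := by
    rw [← krylov_mulVec, krylov_Zunit_single_zero, Matrix.one_mulVec]
  have hcomm : Commute (∑ j : Fin n, w j • Zunit R n f ^ (j : ℕ))
      (∑ j : Fin n, v j • Zunit R n f ^ (j : ℕ)) :=
    Commute.sum_left _ _ _ fun i _ => Commute.sum_right _ _ _ fun j _ =>
      ((Commute.pow_pow_self _ _ _).smul_left _).smul_right _
  rw [Zcirc, Zcirc, krylov_mulVec, krylov_mulVec]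
  conv_lhs => rw [← hrep v]
  conv_rhs => rw [← hrep w]
  rw [Matrix.mulVec_mulVec, Matrix.mulVec_mulVec, hcomm.eq]

theorem toeplitz_like_jacobians {n : ℕ} (g h x : Fin n → ℝ) :
    (Zcirc ℝ n 1 g * Zcirc ℝ n (-1) h).mulVec x
        = (Zcirc ℝ n 1 ((Zcirc ℝ n (-1) h).mulVec x)).mulVec g ∧
    (Zcirc ℝ n 1 g * Zcirc ℝ n (-1) h).mulVec x
        = (Zcirc ℝ n 1 g * Zcirc ℝ n (-1) x).mulVec h := by
  simp only [← Matrix.mulVec_mulVec]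
  exact ⟨Zcirc_mulVec_comm 1 g _, by rw [Zcirc_mulVec_comm (-1) h x]⟩
end
end
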